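/- Every automorphism of K fixing E pointwise is the identity; that is, the automorphism group of the field extension E ⊆ K is trivial: every σ : K ≃ₐ[E] K equals the identity (equivalently, K ≃ₐ[E] K is a subsingleton). -/

import Mathlib

noncomputable section

abbrev R2 : Type := MvPolynomial (Fin 2) ℝ

def x : R2 := MvPolynomial.X 0
def y : R2 := MvPolynomial.X 1
def t : R2 := x * y - 1
def h : R2 := t * (x * t + 1)
def f : R2 := (x * t + 1) ^ 2 * (t ^ 2 + y)
def P : R2 := f + h
def q : R2 := -t ^ 2 - 6 * t * h * (h + 1)
def u : R2 :=
  170 * f * h + 91 * h ^ 2 + 195 * f * h ^ 2 + 69 * h ^ 3 + 75 * f * h ^ 3 + MvPolynomial.C (75 / 4 : ℝ) * h ^ 4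
def Q : R2 := q - u

abbrev K : Type := FractionRing (MvPolynomial (Fin 2) ℝ)

/-- The canonical image of a polynomial in the rational function field `K = ℝ(x,y)`. -/
def ι : R2 →+* K := algebraMap R2 K

/-- The images of `P`, `Q`, `h` in the rational function field `K`. -/
def PK : K := ι P
def QK : K := ι Q
def hK : K := ι h

/-- `E = ℝ(P,Q)`, the intermediate field of `K` over `ℝ` generated by `P` and `Q`. -/
def E : IntermediateField ℝ K := IntermediateField.adjoin ℝ ({PK, QK} : Set K)

section RationalFunctions

open Polynomial

variable {k : Type*} [Field k]

/-- A rational function `G` with `L(G) = L(X)`, where `L = n₀ X⁻² + n₁ X⁻¹ + ⋯ + n₆ X⁴` is a Laurent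
polynomial with `n₀, n₁, n₆ ≠ 0`, is `X` itself. -/
theorem ratFunc_eq_X_of_laurent_eq {n₀ n₁ n₂ n₃ n₄ n₅ n₆ : k} (h₀ : n₀ ≠ 0) (h₁ : n₁ ≠ 0)
    (h₆ : n₆ ≠ 0) {G : RatFunc k} (hG : G ≠ 0)
    (heq : RatFunc.X ^ 2 * (RatFunc.C n₀ + RatFunc.C n₁ * G + RatFunc.C n₂ * G ^ 2
        + RatFunc.C n₃ * G ^ 3 + RatFunc.C n₄ * G ^ 4 + RatFunc.C n₅ * G ^ 5
        + RatFunc.C n₆ * G ^ 6)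
      = G ^ 2 * (RatFunc.C n₀ + RatFunc.C n₁ * RatFunc.X + RatFunc.C n₂ * RatFunc.X ^ 2
        + RatFunc.C n₃ * RatFunc.X ^ 3 + RatFunc.C n₄ * RatFunc.X ^ 4
        + RatFunc.C n₅ * RatFunc.X ^ 5 + RatFunc.C n₆ * RatFunc.X ^ 6)) :
    G = RatFunc.X := by
  obtain ⟨A, B, hB, hAB, rfl⟩ : ∃ A B : k[X], B ≠ 0 ∧ IsCoprime A B ∧
      G = algebraMap k[X] (RatFunc k) A / algebraMap k[X] (RatFunc k) B :=
    ⟨G.num, G.denom, G.denom_ne_zero, G.isCoprime_num_denom, G.num_div_denom.symm⟩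
  have hB' : algebraMap k[X] (RatFunc k) B ≠ 0 := RatFunc.algebraMap_ne_zero hB
  have hA : A ≠ 0 := by
    rintro rfl
    simp at hG
  set N : k[X] := C n₀ + C n₁ * X + C n₂ * X ^ 2 + C n₃ * X ^ 3 + C n₄ * X ^ 4 + C n₅ * X ^ 5
    + C n₆ * X ^ 6 with hN
  set M : k[X] := C n₀ * B ^ 6 + C n₁ * A * B ^ 5 + C n₂ * A ^ 2 * B ^ 4 + C n₃ * A ^ 3 * B ^ 3
    + C n₄ * A ^ 4 * B ^ 2 + C n₅ * A ^ 5 * B + C n₆ * A ^ 6 with hM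
  have key : X ^ 2 * M = A ^ 2 * B ^ 4 * N := by
    apply RatFunc.algebraMap_injective k
    simp only [hM, hN, map_mul, map_add, map_pow, RatFunc.algebraMap_C, RatFunc.algebraMap_X]
    field_simp at heq
    linear_combination heq
  have unitC {c : k} (hc : c ≠ 0) : IsUnit (C c) := isUnit_C.2 hc.isUnit
  have hAM : IsCoprime A M := by
    have : M = C n₀ * B ^ 6 + A * (C n₁ * B ^ 5 + C n₂ * A * B ^ 4 + C n₃ * A ^ 2 * B ^ 3
        + C n₄ * A ^ 3 * B ^ 2 + C n₅ * A ^ 4 * B + C n₆ * A ^ 5) := by rw [hM]; ring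
    rw [this, IsCoprime.add_mul_left_right_iff, isCoprime_mul_unit_left_right (unitC h₀)]
    exact hAB.pow_right
  have hBM : IsCoprime B M := by
    have : M = C n₆ * A ^ 6 + B * (C n₀ * B ^ 5 + C n₁ * A * B ^ 4 + C n₂ * A ^ 2 * B ^ 3
        + C n₃ * A ^ 3 * B ^ 2 + C n₄ * A ^ 4 * B + C n₅ * A ^ 5) := by rw [hM]; ring
    rw [this, IsCoprime.add_mul_left_right_iff, isCoprime_mul_unit_left_right (unitC h₆)]
    exact hAB.symm.pow_right
  have hXN : IsCoprime X N := by
    have : N = C n₀ + X * (C n₁ + C n₂ * X + C n₃ * X ^ 2 + C n₄ * X ^ 3 + C n₅ * X ^ 4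
        + C n₆ * X ^ 5) := by rw [hN]; ring
    rw [this, IsCoprime.add_mul_left_right_iff]
    exact isCoprime_one_right.of_isCoprime_of_dvd_right (unitC h₀).dvd
  have hdvd : A ^ 2 * B ^ 4 ∣ X ^ 2 :=
    (hAM.pow_left.mul_left hBM.pow_left).dvd_of_dvd_mul_right ⟨N, key⟩
  have hdeg : 2 * A.natDegree + 4 * B.natDegree ≤ 2 := by
    have := natDegree_le_of_dvd hdvd (pow_ne_zero 2 X_ne_zero)
    rwa [natDegree_mul (pow_ne_zero 2 hA) (pow_ne_zero 4 hB), natDegree_pow, natDegree_pow,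
      natDegree_X_pow] at this
  obtain ⟨b, rfl⟩ : ∃ b, C b = B := natDegree_eq_zero.1 (by omega)
  have hb : b ≠ 0 := by simpa using hB
  have hXA : X ∣ A := by
    have : (X : k[X]) ∣ A ^ 2 * C b ^ 4 :=
      hXN.dvd_of_dvd_mul_right (key ▸ (dvd_pow_self X two_ne_zero).mul_right M)
    rcases prime_X.dvd_or_dvd this with h | h
    · exact prime_X.dvd_of_dvd_pow h
    · exact absurd (isUnit_of_dvd_unit h ((unitC hb).pow 4)) not_isUnit_X
  obtain ⟨A', rfl⟩ := hXA
  have hA' : A' ≠ 0 := right_ne_zero_of_mul hA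
  rw [natDegree_mul X_ne_zero hA', natDegree_X] at hdeg
  obtain ⟨a, rfl⟩ : ∃ a, C a = A' := natDegree_eq_zero.1 (by omega)
  have ha : a ≠ 0 := by simpa using hA'
  have hMN : M = C (a ^ 2 * b ^ 4) * N :=
    mul_left_cancel₀ (pow_ne_zero 2 (X_ne_zero (R := k))) (by
      rw [key]
      simp only [map_mul, map_pow]
      ring)
  have hcoeff : n₁ * a * b ^ 5 = a ^ 2 * b ^ 4 * n₁ := by
    have := congrArg (fun p : k[X] => p.derivative.eval 0) hMN
    simpa [hM, hN, derivative_pow] using this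
  have hab : a = b := by
    have : (n₁ * a * b ^ 4) * a = (n₁ * a * b ^ 4) * b := by linear_combination -hcoeff
    exact mul_left_cancel₀ (by positivity) this
  subst hab
  rw [map_mul, RatFunc.algebraMap_X, mul_div_assoc, div_self hB', mul_one]

/-- A subfield of `k(X)` containing the constants and `X` is everything. -/
theorem ratFunc_subfield_eq_top {L : Subfield (RatFunc k)} (hC : ∀ a, RatFunc.C a ∈ L)
    (hX : RatFunc.X ∈ L) : L = ⊤ := by
  have hpoly (p : Polynomial k) : algebraMap (Polynomial k) (RatFunc k) p ∈ L := by
    induction p using Polynomial.induction_on' with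
    | add p r hp hr => rw [map_add]; exact add_mem hp hr
    | monomial n a => rw [RatFunc.algebraMap_monomial]; exact mul_mem (hC a) (pow_mem hX n)
  refine eq_top_iff.2 fun G _ => ?_
  rw [← G.num_div_denom]
  exact div_mem (hpoly _) (hpoly _)

end RationalFunctions


section Parametrization

/-- The field `ℝ(p)(w)`, a model of `K` in which `P` and `f` are the variables `p` and `w`. -/
abbrev F : Type := RatFunc (RatFunc ℝ)

def pF : F := RatFunc.C RatFunc.X
def wF : F := RatFunc.X
def hF : F := pF - wF
def dF : F := wF - hF * (hF + 1)
def xF : F := (hF + 1) * wF / dF ^ 2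
def yF : F := (hF * dF + wF) * dF ^ 2 / ((hF + 1) * wF ^ 2)

/-- The homomorphism `ℝ[x, y] → ℝ(p)(w)` sending `P` to `p` and `f` to `w`. -/
def toF : R2 →ₐ[ℝ] F := MvPolynomial.aeval ![xF, yF]

theorem X_add_one_ne_zero : (RatFunc.X + 1 : RatFunc ℝ) ≠ 0 := by
  rw [← RatFunc.algebraMap_X, ← map_one (algebraMap (Polynomial ℝ) (RatFunc ℝ)), ← map_add]
  exact RatFunc.algebraMap_ne_zero (Polynomial.X_add_C_ne_zero 1)

theorem wF_ne_zero : wF ≠ 0 := RatFunc.X_ne_zero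

theorem hF_ne_zero : hF ≠ 0 := by
  have h : hF = algebraMap (Polynomial (RatFunc ℝ)) F
      (Polynomial.C RatFunc.X - Polynomial.X) := by
    simp [hF, pF, wF]
  rw [h]
  refine RatFunc.algebraMap_ne_zero fun h0 => RatFunc.X_ne_zero (K := ℝ) ?_
  simpa using congrArg (Polynomial.eval 0) h0

theorem hF_add_one_ne_zero : hF + 1 ≠ 0 := by
  have h : hF + 1 = algebraMap (Polynomial (RatFunc ℝ)) F
      (Polynomial.C RatFunc.X - Polynomial.X + 1) := by
    simp [hF, pF, wF]
  rw [h]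
  refine RatFunc.algebraMap_ne_zero fun h0 => X_add_one_ne_zero ?_
  simpa using congrArg (Polynomial.eval 0) h0

theorem dF_ne_zero : dF ≠ 0 := by
  have h : dF = algebraMap (Polynomial (RatFunc ℝ)) F
      (Polynomial.X - (Polynomial.C RatFunc.X - Polynomial.X) *
        (Polynomial.C RatFunc.X - Polynomial.X + 1)) := by
    simp [dF, hF, pF, wF]
  rw [h]
  refine RatFunc.algebraMap_ne_zero fun h0 =>
    mul_ne_zero RatFunc.X_ne_zero X_add_one_ne_zero ?_
  simpa using congrArg (Polynomial.eval 0) h0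

theorem toF_t : toF t = hF * dF / wF := by
  have := wF_ne_zero
  have := hF_add_one_ne_zero
  have := dF_ne_zero
  simp only [t, x, y, toF, map_sub, map_mul, map_one, MvPolynomial.aeval_X, Matrix.cons_val_zero,
    Matrix.cons_val_one, xF, yF]
  field_simp
  ring

theorem toF_x_mul_t_add_one : toF (x * t + 1) = wF / dF := by
  have := wF_ne_zero
  have := dF_ne_zero
  rw [map_add, map_mul, toF_t, map_one]
  simp only [x, toF, MvPolynomial.aeval_X, Matrix.cons_val_zero, xF]
  field_simp
  simp only [dF]
  ring

theorem toF_h : toF h = hF := by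
  have := wF_ne_zero
  have := dF_ne_zero
  rw [h, map_mul, toF_x_mul_t_add_one, toF_t]
  field_simp

theorem toF_f : toF f = wF := by
  have := wF_ne_zero
  have := hF_add_one_ne_zero
  have := dF_ne_zero
  rw [f, map_mul, map_pow, toF_x_mul_t_add_one, map_add, map_pow, toF_t]
  simp only [y, toF, MvPolynomial.aeval_X, Matrix.cons_val_one, Matrix.cons_val_fin_one, yF]
  field_simp
  simp only [dF]
  ring

theorem toF_P : toF P = pF := by
  rw [P, map_add, toF_f, toF_h, hF]
  ring

theorem adjoin_xF_yF : IntermediateField.adjoin ℝ (Set.range ![xF, yF]) = ⊤ := by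
  set L := IntermediateField.adjoin ℝ (Set.range ![xF, yF])
  have hmem (r : R2) : toF r ∈ L := by
    induction r using MvPolynomial.induction_on with
    | C a => simp [toF]
    | add r s hr hs => rw [map_add]; exact add_mem hr hs
    | mul_X r i hr =>
      rw [map_mul]
      refine mul_mem hr (IntermediateField.subset_adjoin _ _ ⟨i, ?_⟩)
      simp [toF]
  have hC : L.toSubfield.comap (RatFunc.C : RatFunc ℝ →+* F) = ⊤ :=
    ratFunc_subfield_eq_top (fun a => L.algebraMap_mem a) (by
      have := hmem P
      rwa [toF_P] at this)
  have htop : L.toSubfield = ⊤ :=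
    ratFunc_subfield_eq_top (fun a => (hC ▸ Subfield.mem_top a :)) (by
      have := hmem f
      rwa [toF_f] at this)
  exact IntermediateField.toSubfield_injective htop

theorem two_le_trdeg_F : 2 ≤ Algebra.trdeg ℝ F := by
  have hR : 1 ≤ Algebra.trdeg ℝ (RatFunc ℝ) := Cardinal.one_le_iff_pos.2 (trdeg_pos _ _)
  have hF : 1 ≤ Algebra.trdeg (RatFunc ℝ) F := Cardinal.one_le_iff_pos.2 (trdeg_pos _ _)
  calc (2 : Cardinal) = 1 + 1 := one_add_one_eq_two.symm
    _ ≤ _ := add_le_add hR hF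
    _ ≤ _ := trdeg_add_le

theorem toF_injective : Function.Injective toF := by
  have halg : Algebra.IsAlgebraic (Algebra.adjoin ℝ (Set.range ![xF, yF])) F := by
    have : IsFractionRing (Algebra.adjoin ℝ (Set.range ![xF, yF])) F :=
      .of_field _ _ fun z => by
        have hz : z ∈ IntermediateField.adjoin ℝ (Set.range ![xF, yF]) :=
          adjoin_xF_yF ▸ IntermediateField.mem_top
        obtain ⟨r, hr, s, hs, rfl⟩ := IntermediateField.mem_adjoin_iff_div.1 hz
        exact ⟨⟨r, hr⟩, ⟨s, hs⟩, rfl⟩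
    exact IsLocalization.isAlgebraic _ (nonZeroDivisors (Algebra.adjoin ℝ (Set.range ![xF, yF])))
  exact (Algebra.IsAlgebraic.isTranscendenceBasis_of_le_trdeg_of_finite ℝ ![xF, yF]
    (by simpa using two_le_trdeg_F)).1

end Parametrization

theorem f_mul_t : f * t = f * h - h ^ 2 * (h + 1) := by
  simp only [f, h, t]
  ring

/-- The relation `f² Q = N(P, f)` with `N` a polynomial of degree `6` in `f`. -/
theorem f_sq_mul_Q :
    f ^ 2 * Q = -P ^ 4 * (P + 1) ^ 2 + 12 * P ^ 3 * (P + 1) ^ 2 * f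
      + (-128 * P ^ 2 - 151 * P ^ 3 - MvPolynomial.C (255 / 4 : ℝ) * P ^ 4) * f ^ 2
      + (54 * P + 134 * P ^ 2 + 80 * P ^ 3) * f ^ 3
      + (63 + 99 * P + MvPolynomial.C (75 / 2 : ℝ) * P ^ 2) * f ^ 4
      + (-104 - 114 * P) * f ^ 5 + MvPolynomial.C (197 / 4 : ℝ) * f ^ 6 := by
  have hP : P = f + h := rfl
  have c1 : (MvPolynomial.C (75 / 4 : ℝ) : R2) = 75 * MvPolynomial.C (1 / 4) := by
    rw [← map_ofNat MvPolynomial.C 75, ← map_mul]; norm_num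
  have c2 : (MvPolynomial.C (255 / 4 : ℝ) : R2) = 255 * MvPolynomial.C (1 / 4) := by
    rw [← map_ofNat MvPolynomial.C 255, ← map_mul]; norm_num
  have c3 : (MvPolynomial.C (75 / 2 : ℝ) : R2) = 150 * MvPolynomial.C (1 / 4) := by
    rw [← map_ofNat MvPolynomial.C 150, ← map_mul]; norm_num
  have c4 : (MvPolynomial.C (197 / 4 : ℝ) : R2) = 197 * MvPolynomial.C (1 / 4) := by
    rw [← map_ofNat MvPolynomial.C 197, ← map_mul]; norm_num
  have c5 : 4 * (MvPolynomial.C (1 / 4 : ℝ) : R2) = 1 := by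
    rw [← map_ofNat MvPolynomial.C 4, ← map_mul]; norm_num
  rw [Q, q, u, c1, c2, c3, c4, hP]
  linear_combination
    (-(f * t + (f * h - h ^ 2 * (h + 1))) - 6 * f * h * (h + 1)) * f_mul_t
    + f ^ 2 * (45 * h ^ 4 + 255 * h ^ 3 * f + 345 * h ^ 2 * f ^ 2 + 180 * h * f ^ 3 - 23 * f ^ 4)
      * c5

/-- Over `ℝ`, a homomorphism `ℝ[x, y] → ℝ(p)(w)` that agrees with `toF` on `P` and `Q` and does not
kill `f` agrees with it on `f`. -/
theorem eq_wF_of_map_eq {τ : R2 →+* F} (hC : ∀ r, τ (MvPolynomial.C r) = algebraMap ℝ F r)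
    (hP : τ P = pF) (hQ : τ Q = toF Q) (hf : τ f ≠ 0) : τ f = wF := by
  have hτ := congrArg τ f_sq_mul_Q
  have hF := congrArg toF f_sq_mul_Q
  have hC' (r : ℝ) : toF (MvPolynomial.C r) = algebraMap ℝ F r := toF.commutes r
  simp only [map_add, map_sub, map_mul, map_pow, map_neg, map_ofNat, map_one, hC, hC', hP, hQ,
    toF_P, toF_f] at hτ hF
  have hX := RatFunc.X_ne_zero (K := ℝ)
  refine ratFunc_eq_X_of_laurent_eq
    (n₀ := -RatFunc.X ^ 4 * (RatFunc.X + 1) ^ 2)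
    (n₁ := 12 * RatFunc.X ^ 3 * (RatFunc.X + 1) ^ 2)
    (n₂ := -128 * RatFunc.X ^ 2 - 151 * RatFunc.X ^ 3
      - algebraMap ℝ (RatFunc ℝ) (255 / 4) * RatFunc.X ^ 4)
    (n₃ := 54 * RatFunc.X + 134 * RatFunc.X ^ 2 + 80 * RatFunc.X ^ 3)
    (n₄ := 63 + 99 * RatFunc.X + algebraMap ℝ (RatFunc ℝ) (75 / 2) * RatFunc.X ^ 2)
    (n₅ := -104 - 114 * RatFunc.X)
    (n₆ := algebraMap ℝ (RatFunc ℝ) (197 / 4)) ?_ ?_ ?_ hf ?_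
  · exact mul_ne_zero (neg_ne_zero.2 (pow_ne_zero 4 hX)) (pow_ne_zero 2 X_add_one_ne_zero)
  · exact mul_ne_zero (mul_ne_zero (by norm_num) (pow_ne_zero 3 hX))
      (pow_ne_zero 2 X_add_one_ne_zero)
  · exact (map_ne_zero _).2 (by norm_num)
  · have hCC (r : ℝ) : (RatFunc.C (algebraMap ℝ (RatFunc ℝ) r) : F) = algebraMap ℝ F r := rfl
    have hp : RatFunc.C (RatFunc.X : RatFunc ℝ) = pF := rfl
    have hw : (RatFunc.X : F) = wF := rfl
    simp only [map_add, map_sub, map_mul, map_pow, map_neg, map_ofNat, map_one, hCC, hp, hw]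
    linear_combination τ f ^ 2 * hF - wF ^ 2 * hτ

theorem ι_injective : Function.Injective ι := IsFractionRing.injective R2 K

theorem ι_C (r : ℝ) : ι (MvPolynomial.C r) = algebraMap ℝ K r :=
  (IsScalarTower.algebraMap_apply ℝ R2 K r).symm

theorem ι_ne_zero_of_toF {r : R2} (hr : toF r ≠ 0) : ι r ≠ 0 :=
  (map_ne_zero_iff ι ι_injective).2 fun h0 => hr (by rw [h0, map_zero])

/-- `P` and `f` generate the field `K` over `ℝ`. -/
theorem eq_id_of_map_eq {σ : K →+* K} (hC : ∀ r, σ (algebraMap ℝ K r) = algebraMap ℝ K r)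
    (hP : σ (ι P) = ι P) (hf : σ (ι f) = ι f) : σ = RingHom.id K := by
  have hf0 : ι f ≠ 0 := ι_ne_zero_of_toF (toF_f ▸ wF_ne_zero)
  have hh : σ (ι h) = ι h := by
    have : ι h = ι P - ι f := by rw [P, map_add]; ring
    rw [this, map_sub, hP, hf]
  have hft : ι f * ι t = ι f * ι h - ι h ^ 2 * (ι h + 1) := by
    rw [← map_mul, f_mul_t]
    simp
  have ht : σ (ι t) = ι t := by
    have := congrArg σ hft
    simp only [map_mul, map_sub, map_pow, map_add, map_one, hf, hh] at this
    exact mul_left_cancel₀ hf0 (this.trans hft.symm)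
  have ht0 : ι t ≠ 0 := ι_ne_zero_of_toF <| by
    rw [toF_t]
    exact div_ne_zero (mul_ne_zero hF_ne_zero dF_ne_zero) wF_ne_zero
  have hx0 : ι x ≠ 0 := (map_ne_zero_iff ι ι_injective).2 (MvPolynomial.X_ne_zero 0)
  have hxt : ι t * (ι x * ι t + 1) = ι h := by simp [h]
  have hx : σ (ι x) = ι x := by
    have := congrArg σ hxt
    simp only [map_mul, map_add, map_one, hh, ht] at this
    refine mul_right_cancel₀ (pow_ne_zero 2 ht0) ?_
    linear_combination this - hxt
  have hxy : ι x * ι y = ι t + 1 := by simp [t]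
  have hy : σ (ι y) = ι y := by
    have := congrArg σ hxy
    simp only [map_mul, map_add, map_one, hx, ht] at this
    exact mul_left_cancel₀ hx0 (this.trans hxy.symm)
  refine IsFractionRing.injective_comp_algebraMap (A := R2) (MvPolynomial.ringHom_ext ?_ ?_)
  · intro r
    change σ (ι (MvPolynomial.C r)) = ι (MvPolynomial.C r)
    rw [ι_C, hC]
  · intro i
    fin_cases i
    · exact hx
    · exact hy

/-- The automorphism group of the field extension `ℝ(P,Q) ⊆ ℝ(x,y)` is trivial. -/
theorem pinchuk_trivial_automorphisms (σ : K ≃ₐ[E] K) : σ = AlgEquiv.refl := by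
  have hfix (z : K) (hz : z ∈ E) : σ z = z := σ.commutes ⟨z, hz⟩
  have hC (r : ℝ) : σ (algebraMap ℝ K r) = algebraMap ℝ K r := hfix _ (E.algebraMap_mem r)
  have hP : σ (ι P) = ι P := hfix _ (IntermediateField.subset_adjoin _ _ (.inl rfl))
  have hQ : σ (ι Q) = ι Q := hfix _ (IntermediateField.subset_adjoin _ _ (.inr rfl))
  let φ : K →+* F := IsFractionRing.lift (g := toF.toRingHom) toF_injective
  have hφ (r : R2) : φ (ι r) = toF r := IsFractionRing.lift_algebraMap _ r
  have hf : σ (ι f) = ι f := by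
    refine φ.injective ?_
    rw [hφ, toF_f]
    refine eq_wF_of_map_eq (τ := (φ.comp (σ : K →+* K)).comp ι) (fun r => ?_) ?_ ?_ ?_
    · change φ (σ (ι _)) = _
      rw [ι_C, hC, ← ι_C, hφ]
      exact toF.commutes r
    · change φ (σ (ι _)) = _
      rw [hP, hφ, toF_P]
    · change φ (σ (ι _)) = _
      rw [hQ, hφ]
    · change φ (σ (ι _)) ≠ _
      exact (map_ne_zero φ).2 ((map_ne_zero σ).2 (ι_ne_zero_of_toF (toF_f ▸ wF_ne_zero)))
  have hid : (σ : K →+* K) = RingHom.id K := eq_id_of_map_eq hC hP hf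
  exact AlgEquiv.ext fun z => RingHom.congr_fun hid z
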